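/- Let λ = sup_{t∈(0,1)} sup_{α≠0} ‖Σ^{−1/2}XᵀD(B̂+tα)Xα‖²/‖Σ^{1/2}α‖². Then λ^{1/2} ≤ λ_max( Σ^{−1/2} XᵀX Σ^{−1/2} ) − (2/π) · min_{1≤j≤2^p} λ_min( Σ^{−1/2} W(S_j) Σ^{−1/2} ), where for each of the 2^p open orthants S_j of ℝ^p, W(S_j) = ∑_{i : X_i ∈ S_j} X_i 1{Y_i=0} X_iᵀ + ∑_{i : X_i ∈ −S_j} X_i 1{Y_i=1} X_iᵀ, and λ_max, λ_min denote the largest and smallest eigenvalues. -/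

import Mathlib

open MeasureTheory Matrix Filter

noncomputable section

/-- standard normal pdf -/
def nphi (x : ℝ) : ℝ := (Real.sqrt (2 * Real.pi))⁻¹ * Real.exp (-(x ^ 2) / 2)

/-- standard normal cdf -/
def nPhi (x : ℝ) : ℝ := ∫ t in Set.Iic x, nphi t

/-- density of TN(θ,1;1) (if b = true) resp. TN(θ,1;0) (if b = false) at z -/
def tn (θ : ℝ) (b : Bool) (z : ℝ) : ℝ :=
  if b then (if 0 < z then nphi (z - θ) / nPhi θ else 0)
  else (if z < 0 then nphi (z - θ) / (1 - nPhi θ) else 0)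

/-- p-variate Gaussian density with mean μ and covariance matrix Λ -/
def mvn {p : ℕ} (μ : Fin p → ℝ) (Λ : Matrix (Fin p) (Fin p) ℝ) (x : Fin p → ℝ) : ℝ :=
  Real.sqrt (((2 * Real.pi) ^ p * Λ.det)⁻¹) *
    Real.exp (-(dotProduct (x - μ) (Λ⁻¹.mulVec (x - μ))) / 2)

/-- squared Euclidean norm -/
def normSq {m : ℕ} (x : Fin m → ℝ) : ℝ := ∑ i, x i ^ 2

/-- Albert and Chib's Markov transition density, with Σ = XᵀX + Q -/
def kAC {n p : ℕ} (X : Matrix (Fin n) (Fin p) ℝ) (Y : Fin n → Bool)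
    (v : Fin p → ℝ) (Q : Matrix (Fin p) (Fin p) ℝ) (β β' : Fin p → ℝ) : ℝ :=
  ∫ z : Fin n → ℝ,
    mvn ((Xᵀ * X + Q)⁻¹.mulVec (Xᵀ.mulVec z + Q.mulVec v)) (Xᵀ * X + Q)⁻¹ β' *
      ∏ i, tn (dotProduct (X i) β) (Y i) (z i)

/-- the defining property of the posterior mode B̂ -/
def IsPosteriorMode {n p : ℕ} (X : Matrix (Fin n) (Fin p) ℝ) (Y : Fin n → Bool)
    (v : Fin p → ℝ) (Q : Matrix (Fin p) (Fin p) ℝ) (Bhat : Fin p → ℝ) : Prop :=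
  (∑ i, (if Y i then nphi (dotProduct (X i) Bhat) / nPhi (dotProduct (X i) Bhat)
          else -(nphi (dotProduct (X i) Bhat) / (1 - nPhi (dotProduct (X i) Bhat)))) • X i)
    - Q.mulVec (Bhat - v) = 0

/-- g(θ) = θφ(θ)/Φ(θ) + (φ(θ)/Φ(θ))² -/
def gfun (θ : ℝ) : ℝ := θ * nphi θ / nPhi θ + (nphi θ / nPhi θ) ^ 2

/-- the diagonal matrix D(β) -/
def Dmat {n p : ℕ} (X : Matrix (Fin n) (Fin p) ℝ) (Y : Fin n → Bool) (β : Fin p → ℝ) :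
    Matrix (Fin n) (Fin n) ℝ :=
  Matrix.diagonal fun i =>
    1 - (if Y i then gfun (dotProduct (X i) β) else gfun (-(dotProduct (X i) β)))

/-- largest eigenvalue of a symmetric real matrix, as the supremum of the
Rayleigh quotient -/
def lmax {m : ℕ} (M : Matrix (Fin m) (Fin m) ℝ) : ℝ :=
  sSup {r : ℝ | ∃ x : Fin m → ℝ, x ≠ 0 ∧ r = dotProduct x (M.mulVec x) / normSq x}

/-- smallest eigenvalue of a symmetric real matrix, as the infimum of the
Rayleigh quotient -/
def lmin {m : ℕ} (M : Matrix (Fin m) (Fin m) ℝ) : ℝ :=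
  sInf {r : ℝ | ∃ x : Fin m → ℝ, x ≠ 0 ∧ r = dotProduct x (M.mulVec x) / normSq x}

/-- membership of x in the open orthant of ℝ^p determined by the sign pattern s -/
def inOrth {p : ℕ} (s : Fin p → Bool) (x : Fin p → ℝ) : Prop :=
  ∀ k, if s k then 0 < x k else x k < 0

open Classical in
/-- W(S_j) = ∑_{i : X_i ∈ S_j} X_i 1{Y_i=0} X_iᵀ + ∑_{i : X_i ∈ −S_j} X_i 1{Y_i=1} X_iᵀ,
for the orthant S_j determined by the sign pattern s -/
noncomputable def Worth {n p : ℕ} (X : Matrix (Fin n) (Fin p) ℝ) (Y : Fin n → Bool)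
    (s : Fin p → Bool) : Matrix (Fin p) (Fin p) ℝ :=
  ∑ i, (((if inOrth s (X i) ∧ Y i = false then (1 : ℝ) else 0) +
         (if inOrth s (-(X i : Fin p → ℝ)) ∧ Y i = true then (1 : ℝ) else 0)) •
          Matrix.vecMulVec (X i) (X i))

lemma aux_quad {n p : ℕ} (X : Matrix (Fin n) (Fin p) ℝ) (w : Fin n → ℝ) (T : Matrix (Fin p) (Fin p) ℝ)
   (hT : Tᵀ = T) (z : Fin p → ℝ) :
   dotProduct z ((T * (∑ i, w i • Matrix.vecMulVec (X i) (X i)) * T).mulVec z)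
     = ∑ i, w i * (dotProduct (X i) (T.mulVec z))^2 := by
  rw [← Matrix.mulVec_mulVec, ← Matrix.mulVec_mulVec, Matrix.dotProduct_mulVec, ← Matrix.mulVec_transpose, hT,
    Matrix.sum_mulVec, dotProduct_sum]
  refine Finset.sum_congr rfl fun i _ => ?_
  rw [Matrix.smul_mulVec, Matrix.vecMulVec_mulVec]
  rw [dotProduct_smul, dotProduct_smul, dotProduct_comm (T.mulVec z)]
  simp only [smul_eq_mul, MulOpposite.smul_eq_mul_unop, MulOpposite.unop_op]
  ring

lemma aux_XX {n p : ℕ} (X : Matrix (Fin n) (Fin p) ℝ) :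
   Xᵀ * X = ∑ i, (1:ℝ) • Matrix.vecMulVec (X i) (X i) := by
  ext a b
  simp [Matrix.mul_apply, Matrix.sum_apply, Matrix.vecMulVec_apply]

lemma normSq_eq {m : ℕ} (x : Fin m → ℝ) : normSq x = dotProduct x x := by
  simp [normSq, dotProduct, sq]

lemma normSq_pos' {m : ℕ} (x : Fin m → ℝ) (hx : x ≠ 0) : 0 < normSq x := by
  obtain ⟨i, hi⟩ := Function.ne_iff.mp hx
  exact Finset.sum_pos' (fun j _ => sq_nonneg _) ⟨i, Finset.mem_univ _, sq_pos_of_ne_zero (by simpa using hi)⟩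

lemma le_lmax {m : ℕ} (M : Matrix (Fin m) (Fin m) ℝ) (K : ℝ)
    (hK : ∀ x, dotProduct x (M.mulVec x) ≤ K * normSq x) (x : Fin m → ℝ) :
    dotProduct x (M.mulVec x) ≤ lmax M * normSq x := by
  by_cases hx : x = 0
  · simp [hx, normSq]
  · rw [← div_le_iff₀ (normSq_pos' x hx)]
    apply le_csSup
    · refine ⟨K, ?_⟩
      rintro r ⟨y, hy, rfl⟩
      rw [div_le_iff₀ (normSq_pos' y hy)]
      exact hK y
    · exact ⟨x, hx, rfl⟩

lemma lmin_le {m : ℕ} (M : Matrix (Fin m) (Fin m) ℝ) (K : ℝ)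
    (hK : ∀ x, K * normSq x ≤ dotProduct x (M.mulVec x)) (x : Fin m → ℝ) :
    lmin M * normSq x ≤ dotProduct x (M.mulVec x) := by
  by_cases hx : x = 0
  · simp [hx, normSq]
  · rw [← le_div_iff₀ (normSq_pos' x hx)]
    apply csInf_le
    · refine ⟨K, ?_⟩
      rintro r ⟨y, hy, rfl⟩
      rw [le_div_iff₀ (normSq_pos' y hy)]
      exact hK y
    · exact ⟨x, hx, rfl⟩

lemma nphi_pos (x : ℝ) : 0 < nphi x := by unfold nphi; positivity

lemma nphi_neg (x : ℝ) : nphi (-x) = nphi x := by simp [nphi]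

lemma nphi_eq : nphi = fun x => (Real.sqrt (2 * Real.pi))⁻¹ * Real.exp (-(1/2) * x ^ 2) := by
  funext x; unfold nphi; congr 2; ring

lemma nphi_cont : Continuous nphi := by unfold nphi; fun_prop

lemma nphi_int : Integrable nphi := by
  rw [nphi_eq]
  exact (integrable_exp_neg_mul_sq (by norm_num)).const_mul _

lemma nphi_int1 : Integrable (fun x => x * nphi x) := by
  rw [nphi_eq]
  refine ((integrable_mul_exp_neg_mul_sq (b := 1/2) (by norm_num)).const_mul
    (Real.sqrt (2 * Real.pi))⁻¹).congr (Eventually.of_forall fun x => ?_)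
  simp only
  ring

lemma nphi_int2 : Integrable (fun x => x ^ 2 * nphi x) := by
  rw [nphi_eq]
  refine ((integrable_rpow_mul_exp_neg_mul_sq (b := 1/2) (by norm_num) (s := 2) (by norm_num)).const_mul
    (Real.sqrt (2 * Real.pi))⁻¹).congr (Eventually.of_forall fun x => ?_)
  simp only [Real.rpow_two]
  ring

lemma nphi_deriv (x : ℝ) : HasDerivAt nphi (-x * nphi x) x := by
  have h : HasDerivAt (fun x : ℝ => -(x ^ 2) / 2) (-x) x := by
    have := ((hasDerivAt_pow 2 x).neg).div_const 2
    refine this.congr_deriv ?_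
    norm_num
    ring
  have := (h.exp).const_mul (Real.sqrt (2 * Real.pi))⁻¹
  refine this.congr_deriv ?_
  unfold nphi; ring

lemma nphi_deriv1 (x : ℝ) : HasDerivAt (fun x => x * nphi x) (nphi x - x ^ 2 * nphi x) x := by
  refine ((hasDerivAt_id' x).mul (nphi_deriv x)).congr_deriv ?_
  ring

lemma nphi_m1 (θ : ℝ) : ∫ t in Set.Iic θ, t * nphi t = - nphi θ := by
  have hd : ∀ x ∈ Set.Iic θ, HasDerivAt (fun x => - nphi x) (x * nphi x) x := fun x _ => by
    exact (nphi_deriv x).neg.congr_deriv (by ring)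
  have := integral_Iic_of_hasDerivAt_of_tendsto' hd nphi_int1.integrableOn
    (tendsto_zero_of_hasDerivAt_of_integrableOn_Iic hd nphi_int1.integrableOn nphi_int.neg.integrableOn)
  simpa using this

lemma nphi_m2 (θ : ℝ) : ∫ t in Set.Iic θ, t ^ 2 * nphi t = nPhi θ - θ * nphi θ := by
  have hi : IntegrableOn (fun x => nphi x - x ^ 2 * nphi x) (Set.Iic θ) :=
    (nphi_int.sub nphi_int2).integrableOn
  have := integral_Iic_of_hasDerivAt_of_tendsto' (fun x (_ : x ∈ Set.Iic θ) => nphi_deriv1 x) hi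
    (tendsto_zero_of_hasDerivAt_of_integrableOn_Iic (fun x _ => nphi_deriv1 x) hi nphi_int1.integrableOn)
  rw [integral_sub nphi_int.integrableOn nphi_int2.integrableOn] at this
  unfold nPhi
  linarith

lemma nPhi_pos (θ : ℝ) : 0 < nPhi θ := by
  unfold nPhi
  rw [setIntegral_pos_iff_support_of_nonneg_ae (Eventually.of_forall fun x => (nphi_pos x).le)
    nphi_int.integrableOn]
  have : Function.support nphi = Set.univ := by
    ext x; simpa using (nphi_pos x).ne'
  simp [this]

lemma nPhi_deriv (x : ℝ) : HasDerivAt nPhi (nphi x) x := by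
  have h : nPhi = fun y => (∫ t in (0:ℝ)..y, nphi t) + nPhi 0 := by
    funext y
    unfold nPhi
    rw [← intervalIntegral.integral_Iic_sub_Iic nphi_int.integrableOn nphi_int.integrableOn]
    ring
  rw [h]
  exact (intervalIntegral.integral_hasDerivAt_right (nphi_cont.intervalIntegrable _ _)
    (nphi_cont.stronglyMeasurableAtFilter _ _) nphi_cont.continuousAt).add_const _

lemma nPhi_zero : nPhi 0 = 1 / 2 := by
  unfold nPhi
  have h : ∫ t in Set.Iic (0:ℝ), nphi t = ∫ t in Set.Ioi (0:ℝ), nphi t := by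
    have := integral_comp_neg_Iic (0:ℝ) nphi
    simpa [nphi_neg] using this
  rw [h, nphi_eq, integral_const_mul, integral_gaussian_Ioi]
  have : Real.pi / (1/2) = 2 * Real.pi := by ring
  rw [this]
  have : 0 < Real.sqrt (2 * Real.pi) := by positivity
  field_simp

lemma gfun_eq (θ : ℝ) : gfun θ = nphi θ * (nphi θ + θ * nPhi θ) / (nPhi θ)^2 := by
  have := (nPhi_pos θ).ne'
  unfold gfun
  field_simp
  ring

lemma gfun_nonneg (θ : ℝ) : 0 ≤ gfun θ := by
  have h : 0 ≤ ∫ t in Set.Iic θ, (θ * nphi t - t * nphi t) := by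
    refine setIntegral_nonneg measurableSet_Iic fun t ht => ?_
    have : t ≤ θ := ht
    nlinarith [nphi_pos t]
  rw [integral_sub (nphi_int.const_mul θ).integrableOn nphi_int1.integrableOn, nphi_m1,
    integral_const_mul] at h
  rw [gfun_eq]
  have h' : 0 ≤ nphi θ + θ * nPhi θ := by unfold nPhi; linarith
  have := nphi_pos θ
  positivity

lemma gfun_le_one (θ : ℝ) : gfun θ ≤ 1 := by
  set P := nPhi θ with hP
  set f := nphi θ with hf
  have hPp : 0 < P := nPhi_pos θ
  have h : 0 ≤ ∫ t in Set.Iic θ, (P ^ 2 * (t ^ 2 * nphi t) + (2 * P * f * (t * nphi t) + f ^ 2 * nphi t)) := by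
    refine setIntegral_nonneg measurableSet_Iic fun t ht => ?_
    have : P ^ 2 * (t ^ 2 * nphi t) + (2 * P * f * (t * nphi t) + f ^ 2 * nphi t) = (P * t + f)^2 * nphi t := by ring
    rw [this]
    have := nphi_pos t
    positivity
  have hi : IntegrableOn (fun t => 2 * P * f * (t * nphi t) + f ^ 2 * nphi t) (Set.Iic θ) :=
    ((nphi_int1.const_mul _).add (nphi_int.const_mul _)).integrableOn
  rw [integral_add (nphi_int2.const_mul _).integrableOn hi,
    integral_add (nphi_int1.const_mul _).integrableOn (nphi_int.const_mul _).integrableOn,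
    integral_const_mul, integral_const_mul, integral_const_mul, nphi_m1, nphi_m2] at h
  have h2 : ∫ t in Set.Iic θ, nphi t = P := rfl
  rw [h2, ← hP, ← hf] at h
  rw [gfun_eq, ← hP, ← hf, div_le_one (by positivity)]
  have h3 : 0 ≤ P * (P ^ 2 - f * (f + θ * P)) := by nlinarith
  nlinarith [nonneg_of_mul_nonneg_right h3 hPp]

/-- the auxiliary function in the Mills ratio bound -/
def millsF (x : ℝ) : ℝ :=
  nphi x * (2 * (Real.sqrt (x ^ 2 + 8 / Real.pi) - x) / (8 / Real.pi)) - nPhi (-x)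

lemma millsF_deriv (x : ℝ) : HasDerivAt millsF
    (nphi x * ((x ^ 2 + 8 / Real.pi - 2 - x * Real.sqrt (x ^ 2 + 8 / Real.pi)) /
      (Real.sqrt (x ^ 2 + 8 / Real.pi) * (Real.sqrt (x ^ 2 + 8 / Real.pi) + x)))) x := by
  have hc : 0 < 8 / Real.pi := by positivity
  unfold millsF
  generalize 8 / Real.pi = c at *
  have hpos : 0 < x ^ 2 + c := by positivity
  have hr2 : Real.sqrt (x ^ 2 + c) ^ 2 = x ^ 2 + c := Real.sq_sqrt hpos.le
  have hr0 : 0 < Real.sqrt (x ^ 2 + c) := Real.sqrt_pos.mpr hpos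
  have h1 : HasDerivAt (fun x : ℝ => Real.sqrt (x ^ 2 + c)) (x / Real.sqrt (x ^ 2 + c)) x := by
    have := ((hasDerivAt_pow 2 x).add_const c).sqrt hpos.ne'
    refine this.congr_deriv ?_
    norm_num
    field_simp
  have h2 : HasDerivAt (fun x => nPhi (-x)) (-nphi x) x := by
    have := (nPhi_deriv (-x)).comp x (hasDerivAt_neg x)
    rw [nphi_neg] at this
    exact this.congr_deriv (by ring)
  have h3 := ((nphi_deriv x).mul (((h1.sub (hasDerivAt_id' x)).const_mul 2).div_const c)).sub h2
  refine h3.congr_deriv ?_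
  simp only [Pi.sub_apply]
  set r := Real.sqrt (x ^ 2 + c)
  have hrx : 0 < r + x := by
    have : |x| < r := by
      apply abs_lt_of_sq_lt_sq _ hr0.le
      linarith
    linarith [neg_abs_le x]
  have hcc : c = (r - x) * (r + x) := by linarith
  have hrx' : r - x ≠ 0 := by
    rintro h; rw [h] at hcc; linarith
  have e1 : x ^ 2 + c - 2 = r ^ 2 - 2 := by linarith
  rw [e1, hcc]
  field_simp
  ring

lemma millsF_zero : millsF 0 = 0 := by
  unfold millsF
  rw [neg_zero, nPhi_zero]
  unfold nphi
  have h1 : Real.sqrt (0 ^ 2 + 8 / Real.pi) = 4 / Real.sqrt (2 * Real.pi) := by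
    rw [Real.sqrt_eq_iff_mul_self_eq (by positivity) (by positivity), div_mul_div_comm,
      Real.mul_self_sqrt (by positivity)]
    field_simp; norm_num
  rw [h1]
  have h2 : 0 < Real.sqrt (2 * Real.pi) := by positivity
  have h3 : Real.sqrt (2 * Real.pi) ^ 2 = 2 * Real.pi := Real.sq_sqrt (by positivity)
  generalize Real.sqrt (2 * Real.pi) = q at *
  have h4 : Real.pi = q ^ 2 / 2 := by linarith
  rw [h4]
  simp
  field_simp
  ring

lemma millsF_tendsto : Tendsto millsF atTop (nhds 0) := by
  have h1 : Tendsto (fun x => nPhi (-x)) atTop (nhds 0) :=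
    tendsto_integral_Iic_zero tendsto_neg_atTop_atBot
  have h0 : Tendsto nphi atTop (nhds 0) := 
    tendsto_zero_of_hasDerivAt_of_integrableOn_Ioi (a := 0) (fun x _ => nphi_deriv x)
      (by simpa using nphi_int1.neg.integrableOn) nphi_int.integrableOn
  have h2 : Tendsto (fun x => nphi x *
      (2 * (Real.sqrt (x ^ 2 + 8 / Real.pi) - x) / (8 / Real.pi))) atTop (nhds 0) := by
    have hc : 0 < 8 / Real.pi := by positivity
    generalize 8 / Real.pi = c at *
    have h3 : Tendsto (fun x => nphi x * (2 * Real.sqrt c / c)) atTop (nhds 0) := by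
      simpa using h0.mul_const (2 * Real.sqrt c / c)
    refine squeeze_zero' ?_ ?_ h3
    · filter_upwards [eventually_ge_atTop 0] with x hx
      have : x ≤ Real.sqrt (x ^ 2 + c) := Real.le_sqrt_of_sq_le (by linarith)
      have := nphi_pos x
      have : 0 ≤ Real.sqrt (x ^ 2 + c) - x := by linarith
      positivity
    · filter_upwards [eventually_ge_atTop 0] with x hx
      have : Real.sqrt (x ^ 2 + c) ≤ x + Real.sqrt c := by
        apply Real.sqrt_le_iff.mpr ⟨by positivity, ?_⟩
        have := Real.sq_sqrt hc.le
        nlinarith [mul_nonneg hx (Real.sqrt_nonneg c)]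
      have := nphi_pos x
      gcongr
      linarith
  have := h2.sub h1
  rw [sub_zero] at this
  exact this

lemma millsF_nonneg (x : ℝ) (hx : 0 ≤ x) : 0 ≤ millsF x := by
  have hpi := Real.pi_pos
  have hc2 : 2 < 8 / Real.pi := by
    rw [lt_div_iff₀ hpi]; linarith [Real.pi_lt_four]
  have hc4 : 8 / Real.pi < 4 := by
    rw [div_lt_iff₀ hpi]; linarith [Real.pi_gt_three]
  have hder := millsF_deriv
  generalize 8 / Real.pi = c at *
  have hcont : Continuous millsF := continuous_iff_continuousAt.mpr fun y => (hder y).continuousAt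
  have hden : ∀ y, 0 ≤ y → 0 < Real.sqrt (y ^ 2 + c) * (Real.sqrt (y ^ 2 + c) + y) := by
    intro y hy
    have : 0 < Real.sqrt (y ^ 2 + c) := Real.sqrt_pos.mpr (by positivity)
    positivity
  by_cases hx0 : (4 - c) * x ^ 2 ≤ (c - 2) ^ 2
  · have hm : MonotoneOn millsF (Set.Icc 0 x) := by
      apply monotoneOn_of_deriv_nonneg (convex_Icc _ _) hcont.continuousOn
      · exact fun y _ => (hder y).differentiableAt.differentiableWithinAt
      · intro y hy
        rw [interior_Icc] at hy
        rw [(hder y).deriv]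
        refine mul_nonneg (nphi_pos y).le (div_nonneg ?_ (hden y hy.1.le).le)
        have h1 : y * Real.sqrt (y ^ 2 + c) ≤ y ^ 2 + c - 2 := by
          apply abs_le_of_sq_le_sq' _ (by nlinarith) |>.2
          rw [mul_pow, Real.sq_sqrt (by positivity)]
          have : y ^ 2 ≤ x ^ 2 := by nlinarith [hy.1, hy.2]
          nlinarith
        linarith
    have := hm (Set.left_mem_Icc.mpr hx) (Set.right_mem_Icc.mpr hx) hx
    rwa [millsF_zero] at this
  · push Not at hx0
    have hm : AntitoneOn millsF (Set.Ici x) := by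
      apply antitoneOn_of_deriv_nonpos (convex_Ici _) hcont.continuousOn
      · exact fun y _ => (hder y).differentiableAt.differentiableWithinAt
      · intro y hy
        rw [interior_Ici] at hy
        have hy' : x < y := hy
        have hy0 : 0 ≤ y := by linarith
        rw [(hder y).deriv]
        refine mul_nonpos_of_nonneg_of_nonpos (nphi_pos y).le
          (div_nonpos_of_nonpos_of_nonneg ?_ (hden y hy0).le)
        have h1 : y ^ 2 + c - 2 ≤ y * Real.sqrt (y ^ 2 + c) := by
          apply abs_le_of_sq_le_sq' _ (by positivity) |>.2
          rw [mul_pow, Real.sq_sqrt (by positivity)]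
          have : x ^ 2 ≤ y ^ 2 := by nlinarith
          nlinarith
        linarith
    refine le_of_tendsto millsF_tendsto ?_
    filter_upwards [eventually_ge_atTop x] with y hy
    exact hm Set.self_mem_Ici hy hy

lemma gfun_ge (θ : ℝ) (h : θ ≤ 0) : 2 / Real.pi ≤ gfun θ := by
  obtain ⟨x, rfl⟩ : ∃ x, θ = -x := ⟨-θ, by ring⟩
  have hx : 0 ≤ x := by linarith
  have hm := millsF_nonneg x hx
  unfold millsF at hm
  unfold gfun
  have hc : 0 < 8 / Real.pi := by positivity
  have e : 2 / Real.pi = (8 / Real.pi) / 4 := by ring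
  rw [e, nphi_neg]
  generalize 8 / Real.pi = c at *
  have hpos : 0 < x ^ 2 + c := by positivity
  have hr2 : Real.sqrt (x ^ 2 + c) ^ 2 = x ^ 2 + c := Real.sq_sqrt hpos.le
  have hr0 : x < Real.sqrt (x ^ 2 + c) := Real.lt_sqrt_of_sq_lt (by linarith)
  set r := Real.sqrt (x ^ 2 + c)
  have hP := nPhi_pos (-x)
  have hf := nphi_pos x
  set P := nPhi (-x)
  set f := nphi x
  have hh : (r + x) / 2 ≤ f / P := by
    rw [le_div_iff₀ hP]
    have h1 : P ≤ f * (2 * (r - x) / c) := by linarith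
    have h2 : (r + x) / 2 * (f * (2 * (r - x) / c)) = f := by
      have : c = (r - x) * (r + x) := by linarith
      have h3 : r - x ≠ 0 := by linarith
      have h4 : r + x ≠ 0 := by linarith
      rw [this]; field_simp
    calc _ ≤ (r + x) / 2 * (f * (2 * (r - x) / c)) := by
            apply mul_le_mul_of_nonneg_left h1; linarith
      _ = f := h2
  have e2 : -x * f / P = -x * (f / P) := by ring
  rw [e2]
  generalize f / P = h at *
  nlinarith

/-- quadratic form bound -/
lemma key_quad {n p : ℕ} 
    (X : Matrix (Fin n) (Fin p) ℝ) (Y : Fin n → Bool)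
    (T : Matrix (Fin p) (Fin p) ℝ) (hT : Tᵀ = T)
    (hK : ∀ x, dotProduct x ((T * (Xᵀ * X) * T).mulVec x) ≤ 1 * normSq x) (β z : Fin p → ℝ) :
    ∑ i, (1 - (if Y i then gfun (dotProduct (X i) β) else gfun (-(dotProduct (X i) β)))) *
       (dotProduct (X i) (T.mulVec z))^2 
      ≤ (lmax (T * (Xᵀ * X) * T)
        - (2 / Real.pi) * ⨅ s : Fin p → Bool, lmin (T * Worth X Y s * T)) * normSq z := by
  classical
  have h1 := le_lmax _ 1 hK z
  rw [aux_XX, aux_quad _ _ _ hT, ← aux_XX] at h1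
  let s : Fin p → Bool := fun k => decide (0 < β k)
  have h2 := lmin_le (T * Worth X Y s * T) 0 (by
    intro x
    rw [Worth, aux_quad _ _ _ hT, zero_mul]
    refine Finset.sum_nonneg fun i _ => mul_nonneg (add_nonneg ?_ ?_) (sq_nonneg _) <;>
      split_ifs <;> norm_num) z
  rw [Worth, aux_quad _ _ _ hT, ← Worth] at h2
  have h3 : (⨅ s : Fin p → Bool, lmin (T * Worth X Y s * T)) ≤ lmin (T * Worth X Y s * T) :=
    ciInf_le (Set.finite_range _).bddBelow s
  have h4 := mul_le_mul_of_nonneg_right h3 (show 0 ≤ normSq z from Finset.sum_nonneg fun i _ => sq_nonneg _)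
  have hpi : 0 < 2 / Real.pi := by positivity
  have h5 := mul_le_mul_of_nonneg_left (h4.trans h2) hpi.le
  have h6 : (2 / Real.pi) * ∑ i, (((if inOrth s (X i) ∧ Y i = false then (1 : ℝ) else 0) +
         (if inOrth s (-(X i : Fin p → ℝ)) ∧ Y i = true then (1 : ℝ) else 0)) *
          (dotProduct (X i) (T.mulVec z))^2) ≤ 
        ∑ i, (if Y i then gfun (dotProduct (X i) β) else gfun (-(dotProduct (X i) β))) *
       (dotProduct (X i) (T.mulVec z))^2 := by
    rw [Finset.mul_sum]
    refine Finset.sum_le_sum fun i _ => ?_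
    rw [← mul_assoc]
    refine mul_le_mul_of_nonneg_right ?_ (sq_nonneg _)
    cases hY : Y i
    · simp only [and_true, Bool.false_eq_true, and_false, if_false, add_zero]
      split_ifs with ho
      · rw [mul_one]
        apply gfun_ge
        rw [neg_nonpos]
        refine Finset.sum_nonneg fun k _ => ?_
        have := ho k
        by_cases hk : 0 < β k <;> simp [s, hk] at this <;> nlinarith
      · simpa using gfun_nonneg _
    · simp only [and_true, Bool.true_eq_false, and_false, if_false, zero_add, if_true]
      split_ifs with ho
      · rw [mul_one]
        apply gfun_ge
        refine Finset.sum_nonpos fun k _ => ?_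
        have := ho k
        by_cases hk : 0 < β k <;> simp [s, hk] at this <;> nlinarith
      · simpa using gfun_nonneg _
  simp only [sub_mul, one_mul, Finset.sum_sub_distrib] at *
  linarith

theorem lambda_simple_bound
    (n p : ℕ) (hn : 1 ≤ n) (hp : 1 ≤ p)
    (X : Matrix (Fin n) (Fin p) ℝ) (Y : Fin n → Bool)
    (v : Fin p → ℝ) (Q : Matrix (Fin p) (Fin p) ℝ) (hQ : Q.PosSemidef)
    (hSig : IsUnit (Xᵀ * X + Q).det)
    (Bhat : Fin p → ℝ) (hmode : IsPosteriorMode X Y v Q Bhat)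
    (S : Matrix (Fin p) (Fin p) ℝ) (hS : S.PosSemidef) (hSS : S * S = Xᵀ * X + Q)
    (T : Matrix (Fin p) (Fin p) ℝ) (hT : T.PosSemidef) (hTT : T * T = (Xᵀ * X + Q)⁻¹)
    (lam : ℝ)
    (hlamdef : lam = sSup {r : ℝ | ∃ t ∈ Set.Ioo (0 : ℝ) 1, ∃ α : Fin p → ℝ, α ≠ 0 ∧
      r = normSq ((T * Xᵀ * Dmat X Y (Bhat + t • α) * X).mulVec α) / normSq (S.mulVec α)}) :
    Real.sqrt lam
      ≤ lmax (T * (Xᵀ * X) * T)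
        - (2 / Real.pi) * ⨅ s : Fin p → Bool, lmin (T * Worth X Y s * T) := by
  have hTt : Tᵀ = T := by simpa using hT.isHermitian.eq
  have hSt : Sᵀ = S := by simpa using hS.isHermitian.eq
  have hinv : T * (T * (Xᵀ * X + Q)) = 1 := by
    rw [← mul_assoc, hTT, Matrix.nonsing_inv_mul _ hSig]
  have hinv2 : T * (Xᵀ * X + Q) * T = 1 := mul_eq_one_comm.mp hinv
  have hinv3 : (Xᵀ * X + Q) * T * T = 1 := by
    rw [mul_assoc, hTT, Matrix.mul_nonsing_inv _ hSig]
  have hK : ∀ x, dotProduct x ((T * (Xᵀ * X) * T).mulVec x) ≤ 1 * normSq x := by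
    intro x
    have h1 : T * (Xᵀ * X) * T = 1 - T * Q * T := by
      rw [← hinv2]; noncomm_ring
    rw [h1, Matrix.sub_mulVec, dotProduct_sub, Matrix.one_mulVec, normSq_eq, one_mul]
    have h2 : 0 ≤ dotProduct x ((T * Q * T).mulVec x) := by
      rw [← Matrix.mulVec_mulVec, ← Matrix.mulVec_mulVec, Matrix.dotProduct_mulVec,
        ← Matrix.mulVec_transpose, hTt]
      simpa using hQ.dotProduct_mulVec_nonneg (T.mulVec x)
    linarith
  have hkey := key_quad X Y T hTt hK
  set C := lmax (T * (Xᵀ * X) * T)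
        - (2 / Real.pi) * ⨅ s : Fin p → Bool, lmin (T * Worth X Y s * T) with hC
  clear_value C
  have hd : ∀ β i, 0 ≤ (1 - (if Y i then gfun (dotProduct (X i) β) else gfun (-(dotProduct (X i) β)))) := by
    intro β i
    split_ifs
    · linarith [gfun_le_one (dotProduct (X i) β)]
    · linarith [gfun_le_one (-dotProduct (X i) β)]
  have hC0 : 0 ≤ C := by
    have hz : (fun _ => 1 : Fin p → ℝ) ≠ 0 := by
      intro h
      have := congrFun h ⟨0, hp⟩
      simp at this
    have h1 := hkey 0 (fun _ => 1)
    have h2 := normSq_pos' _ hz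
    by_contra hneg
    push Not at hneg
    have h3 := Finset.sum_nonneg (fun i (_ : i ∈ Finset.univ) => mul_nonneg (hd 0 i) (sq_nonneg (dotProduct (X i) (T.mulVec (fun _ => (1:ℝ))))))
    nlinarith [mul_neg_of_neg_of_pos hneg h2]
  apply Real.sqrt_le_iff.mpr ⟨hC0, ?_⟩
  rw [hlamdef]
  apply Real.sSup_le _ (sq_nonneg C)
  rintro r ⟨t, -, α, hα, rfl⟩
  set β := Bhat + t • α
  clear_value β
  set γ := (T * (Xᵀ * X + Q)).mulVec α with hγ
  have hTγ : T.mulVec γ = α := by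
    rw [hγ, Matrix.mulVec_mulVec, hinv, Matrix.one_mulVec]
  have hγγ : normSq (S.mulVec α) = normSq γ := by
    rw [normSq_eq, normSq_eq, Matrix.dotProduct_mulVec, ← Matrix.mulVec_transpose, hSt, Matrix.mulVec_mulVec, hSS]
    conv_rhs => rw [hγ, ← Matrix.mulVec_mulVec, Matrix.dotProduct_mulVec, ← Matrix.mulVec_transpose, hTt, Matrix.mulVec_mulVec,
      Matrix.mulVec_mulVec, mul_assoc, hinv, Matrix.one_mulVec]
    rw [dotProduct_comm]
  rw [hγγ]
  have hγ0 : γ ≠ 0 := by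
    rintro h
    rw [h, Matrix.mulVec_zero] at hTγ
    exact hα hTγ.symm
  rw [div_le_iff₀ (normSq_pos' _ hγ0)]
  set y := (T * Xᵀ * Dmat X Y β * X).mulVec α with hy
  have h1 := hkey β γ
  have h2 := hkey β y
  set d : Fin n → ℝ := fun i => (1 - (if Y i then gfun (dotProduct (X i) β) else gfun (-(dotProduct (X i) β)))) with hdd
  have hyy : normSq y = ∑ i, d i * dotProduct (X i) (T.mulVec γ) * dotProduct (X i) (T.mulVec y) := by
    rw [normSq_eq]
    conv_lhs => enter [2]; rw [hy, ← Matrix.mulVec_mulVec, ← Matrix.mulVec_mulVec, ← Matrix.mulVec_mulVec]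
    rw [Matrix.dotProduct_mulVec, ← Matrix.mulVec_transpose, hTt, Matrix.dotProduct_mulVec, ← Matrix.mulVec_transpose, Matrix.transpose_transpose, hTγ]
    simp only [Dmat, dotProduct, Matrix.mulVec_diagonal]
    refine Finset.sum_congr rfl fun i _ => ?_
    simp only [Matrix.mulVec, dotProduct, hdd]
    ring
  have hCS : (normSq y)^2 ≤ (∑ i, d i * dotProduct (X i) (T.mulVec γ)^2) * (∑ i, d i * dotProduct (X i) (T.mulVec y)^2) := by
    rw [hyy]
    apply Finset.sum_sq_le_sum_mul_sum_of_sq_le_mul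
    · exact fun i _ => mul_nonneg (hd β i) (sq_nonneg _)
    · exact fun i _ => mul_nonneg (hd β i) (sq_nonneg _)
    · intro i _; exact le_of_eq (by ring)
  by_cases hy0 : y = 0
  · rw [hy0]
    have : normSq (0 : Fin p → ℝ) = 0 := by simp [normSq]
    rw [this]
    have := normSq_pos' _ hγ0
    positivity
  · have hp1 := normSq_pos' _ hy0
    have hp2 := normSq_pos' _ hγ0
    have h3 : (normSq y)^2 ≤ (C * normSq γ) * (C * normSq y) := by
      refine hCS.trans (mul_le_mul h1 h2 ?_ (by positivity))
      exact Finset.sum_nonneg fun i _ => mul_nonneg (hd β i) (sq_nonneg _)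
    have h4 : normSq y * normSq y ≤ (C^2 * normSq γ) * normSq y := by nlinarith
    exact le_of_mul_le_mul_right h4 hp1
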